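/- Let f₁, f₂ : ℝ² → ℝ be twice continuously differentiable, ε₁, ε₂ > 0, T > 0, and a₀, b ∈ ℝ². Suppose z = (z₁, z₂) : [0,T] → ℝ² is twice continuously differentiable with z(0) = a₀, z(T) = b, and z minimizes the action ∫₀ᵀ OM(ẇ(t), w(t)) dt over all twice continuously differentiable paths w : [0,T] → ℝ² with w(0) = a₀, w(T) = b. Then for all t ∈ (0,T): z̈₁ = f₁·∂f₁/∂x₁ + (ε₁²/ε₂²)·f₂·∂f₂/∂x₁ + (ε₁²/2)·(∂²f₁/∂x₁² + ∂²f₂/∂x₁∂x₂) + ż₂·(∂f₁/∂x₂ − (ε₁²/ε₂²)·∂f₂/∂x₁) and z̈₂ = f₂·∂f₂/∂x₂ + (ε₂²/ε₁²)·f₁·∂f₁/∂x₂ + (ε₂²/2)·(∂²f₂/∂x₂² + ∂²f₁/∂x₁∂x₂) + ż₁·(∂f₂/∂x₁ − (ε₂²/ε₁²)·∂f₁/∂x₂), where all partial derivatives of f₁, f₂ are evaluated at z(t). -/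

import Mathlib

/-- Partial derivative with respect to the first variable of a function `ℝ → ℝ → ℝ`. -/
noncomputable def pd1 (f : ℝ → ℝ → ℝ) (a b : ℝ) : ℝ := deriv (fun u => f u b) a

/-- Partial derivative with respect to the second variable of a function `ℝ → ℝ → ℝ`. -/
noncomputable def pd2 (f : ℝ → ℝ → ℝ) (a b : ℝ) : ℝ := deriv (fun u => f a u) b

/-- The Onsager–Machlup function for the two-dimensional SDE system
`dX₁ = f₁(X₁, X₂)dt + ε₁ dB¹, dX₂ = f₂(X₁, X₂)dt + ε₂ dB²`:
`OM(v, x) = ((v₁ − f₁(x))/ε₁)² + ((v₂ − f₂(x))/ε₂)² + ∂f₁/∂x₁(x) + ∂f₂/∂x₂(x)`. -/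
noncomputable def OM2 (f1 f2 : ℝ → ℝ → ℝ) (ε1 ε2 : ℝ) (v1 v2 x1 x2 : ℝ) : ℝ :=
  ((v1 - f1 x1 x2) / ε1) ^ 2 + ((v2 - f2 x1 x2) / ε2) ^ 2
    + pd1 f1 x1 x2 + pd2 f2 x1 x2

/-- The Onsager–Machlup action of a two-dimensional path `w = (w₁, w₂)` on `[0, T]`. -/
noncomputable def OM2action (f1 f2 : ℝ → ℝ → ℝ) (ε1 ε2 T : ℝ) (w1 w2 : ℝ → ℝ) : ℝ :=
  ∫ t in (0 : ℝ)..T, OM2 f1 f2 ε1 ε2 (deriv w1 t) (deriv w2 t) (w1 t) (w2 t)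

open MeasureTheory Set

section PartialDerivatives

variable {f : ℝ → ℝ → ℝ}

lemma hasDerivAt_comp_pd (hf : ContDiff ℝ 1 (Function.uncurry f)) {x y : ℝ → ℝ} {x' y' s : ℝ}
    (hx : HasDerivAt x x' s) (hy : HasDerivAt y y' s) :
    HasDerivAt (fun u => f (x u) (y u))
      (pd1 f (x s) (y s) * x' + pd2 f (x s) (y s) * y') s := by
  have key : ∀ {x y : ℝ → ℝ} {x' y' s : ℝ}, HasDerivAt x x' s → HasDerivAt y y' s →
      HasDerivAt (fun u => f (x u) (y u))
        (fderiv ℝ (Function.uncurry f) (x s, y s) (x', y')) s := by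
    intro x y x' y' s hx hy
    exact ((hf.differentiable one_ne_zero (x s, y s)).hasFDerivAt).comp_hasDerivAt s
      (hx.prodMk hy)
  have h1 : pd1 f (x s) (y s) = fderiv ℝ (Function.uncurry f) (x s, y s) (1, 0) :=
    (key (hasDerivAt_id (x s)) (hasDerivAt_const (x s) (y s))).deriv
  have h2 : pd2 f (x s) (y s) = fderiv ℝ (Function.uncurry f) (x s, y s) (0, 1) :=
    (key (hasDerivAt_const (y s) (x s)) (hasDerivAt_id (y s))).deriv
  convert key hx hy using 1
  have : ((x', y') : ℝ × ℝ) = x' • ((1, 0) : ℝ × ℝ) + y' • ((0, 1) : ℝ × ℝ) := by simp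
  rw [this, map_add, map_smul, map_smul, h1, h2]
  simp [mul_comm]

lemma uncurry_pd1 (hf : ContDiff ℝ 1 (Function.uncurry f)) :
    Function.uncurry (pd1 f) = fun p => fderiv ℝ (Function.uncurry f) p (1, 0) := by
  ext p
  exact (((hf.differentiable one_ne_zero p).hasFDerivAt).comp_hasDerivAt p.1
    ((hasDerivAt_id p.1).prodMk (hasDerivAt_const p.1 p.2))).deriv

lemma uncurry_pd2 (hf : ContDiff ℝ 1 (Function.uncurry f)) :
    Function.uncurry (pd2 f) = fun p => fderiv ℝ (Function.uncurry f) p (0, 1) := by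
  ext p
  exact (((hf.differentiable one_ne_zero p).hasFDerivAt).comp_hasDerivAt p.2
    ((hasDerivAt_const p.2 p.1).prodMk (hasDerivAt_id p.2))).deriv

lemma ContDiff.uncurry_pd1 {m n : WithTop ℕ∞} (hf : ContDiff ℝ n (Function.uncurry f))
    (hmn : m + 1 ≤ n) : ContDiff ℝ m (Function.uncurry (pd1 f)) := by
  rw [_root_.uncurry_pd1 (hf.of_le (le_trans le_add_self hmn))]
  exact (hf.fderiv_right hmn).clm_apply contDiff_const

lemma ContDiff.uncurry_pd2 {m n : WithTop ℕ∞} (hf : ContDiff ℝ n (Function.uncurry f))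
    (hmn : m + 1 ≤ n) : ContDiff ℝ m (Function.uncurry (pd2 f)) := by
  rw [_root_.uncurry_pd2 (hf.of_le (le_trans le_add_self hmn))]
  exact (hf.fderiv_right hmn).clm_apply contDiff_const

lemma pd1_pd2_comm (hf : ContDiff ℝ 2 (Function.uncurry f)) (a b : ℝ) :
    pd1 (pd2 f) a b = pd2 (pd1 f) a b := by
  have hf1 : ContDiff ℝ 1 (Function.uncurry f) := hf.of_le (by norm_num)
  have hd : DifferentiableAt ℝ (fderiv ℝ (Function.uncurry f)) (a, b) :=
    (hf.fderiv_right (m := 1) (by norm_num)).differentiable one_ne_zero (a, b)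
  have h1 := congrFun (uncurry_pd1 (hf.uncurry_pd2 (m := 1) (by norm_num))) (a, b)
  have h2 := congrFun (uncurry_pd2 (hf.uncurry_pd1 (m := 1) (by norm_num))) (a, b)
  rw [uncurry_pd2 hf1] at h1
  rw [uncurry_pd1 hf1] at h2
  have hsymm : IsSymmSndFDerivAt ℝ (Function.uncurry f) (a, b) :=
    hf.contDiffAt.isSymmSndFDerivAt (by simp)
  simp only [Function.uncurry_apply_pair] at h1 h2
  rw [h1, h2, fderiv_clm_apply hd (by fun_prop), fderiv_clm_apply hd (by fun_prop)]
  simpa using hsymm.eq (1, 0) (0, 1)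

end PartialDerivatives

/-- Differentiation under the integral sign over a compact interval. -/
lemma hasDerivAt_intervalIntegral_of_continuous {F F' : ℝ → ℝ → ℝ} {a b s₀ : ℝ}
    (hF : Continuous (Function.uncurry F)) (hF' : Continuous (Function.uncurry F'))
    (h : ∀ s t, HasDerivAt (fun s => F s t) (F' s t) s) :
    HasDerivAt (fun s => ∫ t in a..b, F s t) (∫ t in a..b, F' s₀ t) s₀ := by
  have hcF : ∀ s, Continuous (F s) := fun s => hF.comp (by fun_prop : Continuous fun t => (s, t))
  have hcF' : ∀ s, Continuous (F' s) := fun s => hF'.comp (by fun_prop : Continuous fun t => (s, t))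
  obtain ⟨C, hC⟩ := ((isCompact_closedBall s₀ 1).prod
    (isCompact_uIcc (a := a) (b := b))).exists_bound_of_continuousOn hF'.continuousOn
  refine (intervalIntegral.hasDerivAt_integral_of_dominated_loc_of_deriv_le
    (bound := fun _ => C) (Metric.ball_mem_nhds s₀ one_pos)
    (Filter.Eventually.of_forall fun s => (hcF s).aestronglyMeasurable)
    ((hcF s₀).intervalIntegrable a b) (hcF' s₀).aestronglyMeasurable
    (Filter.Eventually.of_forall fun t ht s hs => ?_) intervalIntegrable_const
    (Filter.Eventually.of_forall fun t _ s _ => h s t)).2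
  exact hC (s, t) ⟨Metric.ball_subset_closedBall hs, uIoc_subset_uIcc ht⟩

/-- The fundamental lemma of the calculus of variations on an interval. -/
lemma eq_zero_of_forall_integral_mul_contDiff_eq_zero {g : ℝ → ℝ} {T : ℝ} (hT : 0 ≤ T)
    (hg : Continuous g)
    (h : ∀ η : ℝ → ℝ, ContDiff ℝ 2 η → η 0 = 0 → η T = 0 → ∫ t in (0 : ℝ)..T, g t * η t = 0) :
    ∀ t ∈ Ioo 0 T, g t = 0 := by
  have hae : ∀ᵐ t, t ∈ Ioo 0 T → g t = 0 := by
    refine isOpen_Ioo.ae_eq_zero_of_integral_contDiff_smul_eq_zero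
      (hg.locallyIntegrable.locallyIntegrableOn _) fun η hη _ hsupp => ?_
    have hout : ∀ t, t ∉ Ioo 0 T → η t = 0 := fun t ht =>
      image_eq_zero_of_notMem_tsupport fun h' => ht (hsupp h')
    have h0 := h η (contDiff_infty.1 hη 2) (hout 0 (by simp)) (hout T (by simp))
    rw [intervalIntegral.integral_of_le hT] at h0
    rw [← h0, ← integral_indicator measurableSet_Ioc]
    congr 1
    ext t
    by_cases ht : t ∈ Ioc 0 T
    · simp [indicator_of_mem ht, mul_comm]
    · simp [indicator_of_notMem ht, hout t fun h' => ht (Ioo_subset_Ioc_self h')]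
  exact Measure.eqOn_open_of_ae_eq (f := g) (g := fun _ => 0) (μ := volume)
    ((ae_restrict_iff' measurableSet_Ioo).2 hae) isOpen_Ioo hg.continuousOn continuousOn_const

/-- The Euler–Lagrange equation for a time-dependent Lagrangian `L t v x` with partial
derivatives `Lv`, `Lx`. -/
lemma euler_lagrange_of_minimizer {L Lv Lx : ℝ → ℝ → ℝ → ℝ} {T : ℝ} {z p' : ℝ → ℝ}
    (hT : 0 ≤ T) (hz : ContDiff ℝ 2 z)
    (hL : Continuous fun q : ℝ × ℝ × ℝ => L q.1 q.2.1 q.2.2)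
    (hLv : Continuous fun q : ℝ × ℝ × ℝ => Lv q.1 q.2.1 q.2.2)
    (hLx : Continuous fun q : ℝ × ℝ × ℝ => Lx q.1 q.2.1 q.2.2)
    (hd : ∀ (t : ℝ) (v x : ℝ → ℝ) (v' x' s : ℝ), HasDerivAt v v' s → HasDerivAt x x' s →
      HasDerivAt (fun s => L t (v s) (x s))
        (Lv t (v s) (x s) * v' + Lx t (v s) (x s) * x') s)
    (hp : ∀ t, HasDerivAt (fun t => Lv t (deriv z t) (z t)) (p' t) t) (hp' : Continuous p')
    (hmin : ∀ w : ℝ → ℝ, ContDiff ℝ 2 w → w 0 = z 0 → w T = z T →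
      ∫ t in (0 : ℝ)..T, L t (deriv z t) (z t) ≤ ∫ t in (0 : ℝ)..T, L t (deriv w t) (w t)) :
    ∀ t ∈ Ioo 0 T, p' t = Lx t (deriv z t) (z t) := by
  have hzc : Continuous z := hz.continuous
  have hzd : Continuous (deriv z) := hz.continuous_deriv (by norm_num)
  have hLxz : Continuous fun t => Lx t (deriv z t) (z t) :=
    hLx.comp (by fun_prop : Continuous fun t => (t, deriv z t, z t))
  have hLvz : Continuous fun t => Lv t (deriv z t) (z t) :=
    hLv.comp (by fun_prop : Continuous fun t => (t, deriv z t, z t))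
  refine fun t ht => sub_eq_zero.1 (eq_zero_of_forall_integral_mul_contDiff_eq_zero
    (g := fun t => p' t - Lx t (deriv z t) (z t)) hT (hp'.sub hLxz) ?_ t ht)
  intro η hη hη0 hηT
  have hηc : Continuous η := hη.continuous
  have hηd : Continuous (deriv η) := hη.continuous_deriv (by norm_num)
  have hηD : ∀ t, HasDerivAt η (deriv η t) t := fun t =>
    (hη.differentiable two_ne_zero t).hasDerivAt
  have hpath : Continuous fun q : ℝ × ℝ =>
      (q.2, deriv z q.2 + q.1 * deriv η q.2, z q.2 + q.1 * η q.2) := by fun_prop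
  have hderiv := hasDerivAt_intervalIntegral_of_continuous (a := 0) (b := T) (s₀ := 0)
    (F := fun s t => L t (deriv z t + s * deriv η t) (z t + s * η t))
    (F' := fun s t => Lv t (deriv z t + s * deriv η t) (z t + s * η t) * deriv η t
      + Lx t (deriv z t + s * deriv η t) (z t + s * η t) * η t)
    (hL.comp hpath)
    (((hLv.comp hpath).mul (hηd.comp continuous_snd)).add
      ((hLx.comp hpath).mul (hηc.comp continuous_snd)))
    (fun s t => hd t _ _ _ _ s
      (by simpa using ((hasDerivAt_id s).mul_const (deriv η t)).const_add (deriv z t))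
      (by simpa using ((hasDerivAt_id s).mul_const (η t)).const_add (z t)))
  have hlocmin : IsLocalMin
      (fun s => ∫ t in (0 : ℝ)..T, L t (deriv z t + s * deriv η t) (z t + s * η t)) 0 := by
    refine Filter.Eventually.of_forall fun s => ?_
    have hw := hmin (fun t => z t + s * η t) (by fun_prop) (by simp [hη0]) (by simp [hηT])
    have hwd : ∀ t, deriv (fun t => z t + s * η t) t = deriv z t + s * deriv η t := fun t =>
      ((hz.differentiable two_ne_zero t).hasDerivAt.add ((hηD t).const_mul s)).deriv
    simp only [hwd] at hw
    simpa using hw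
  have h0 := hlocmin.hasDerivAt_eq_zero hderiv
  simp only [zero_mul, add_zero] at h0
  have hparts := intervalIntegral.integral_mul_deriv_eq_deriv_mul (a := 0) (b := T)
    (fun t _ => hp t) (fun t _ => hηD t) (hp'.intervalIntegrable 0 T)
    (hηd.intervalIntegrable 0 T)
  have hi : IntervalIntegrable (fun t => Lx t (deriv z t) (z t) * η t) volume 0 T :=
    (hLxz.mul hηc).intervalIntegrable 0 T
  have hiv : IntervalIntegrable (fun t => Lv t (deriv z t) (z t) * deriv η t) volume 0 T :=
    (hLvz.mul hηd).intervalIntegrable 0 T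
  have hip : IntervalIntegrable (fun t => p' t * η t) volume 0 T :=
    (hp'.mul hηc).intervalIntegrable 0 T
  rw [intervalIntegral.integral_add hiv hi, hparts] at h0
  simp only [sub_mul]
  rw [intervalIntegral.integral_sub hip hi]
  simp only [hη0, hηT] at h0
  linarith

/-- The Euler–Lagrange equation in the first component, when only that component is varied. -/
lemma OM2action_euler_lagrange_fst
    {f1 f2 : ℝ → ℝ → ℝ} {ε1 ε2 T : ℝ} {z1 z2 : ℝ → ℝ}
    (hf1 : ContDiff ℝ 2 (Function.uncurry f1)) (hf2 : ContDiff ℝ 2 (Function.uncurry f2))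
    (hε1 : 0 < ε1) (hε2 : 0 < ε2) (hT : 0 < T)
    (hz1 : ContDiff ℝ 2 z1) (hz2 : ContDiff ℝ 2 z2)
    (hmin : ∀ w : ℝ → ℝ, ContDiff ℝ 2 w → w 0 = z1 0 → w T = z1 T →
      OM2action f1 f2 ε1 ε2 T z1 z2 ≤ OM2action f1 f2 ε1 ε2 T w z2) :
    ∀ t ∈ Ioo (0 : ℝ) T,
      deriv (deriv z1) t
        = f1 (z1 t) (z2 t) * pd1 f1 (z1 t) (z2 t)
          + (ε1 ^ 2 / ε2 ^ 2) * f2 (z1 t) (z2 t) * pd1 f2 (z1 t) (z2 t)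
          + (ε1 ^ 2 / 2) * (pd1 (pd1 f1) (z1 t) (z2 t) + pd1 (pd2 f2) (z1 t) (z2 t))
          + deriv z2 t *
              (pd2 f1 (z1 t) (z2 t) - (ε1 ^ 2 / ε2 ^ 2) * pd1 f2 (z1 t) (z2 t)) := by
  have hf1' : ContDiff ℝ 1 (Function.uncurry f1) := hf1.of_le (by norm_num)
  have hf2' : ContDiff ℝ 1 (Function.uncurry f2) := hf2.of_le (by norm_num)
  have h11 := hf1.uncurry_pd1 (m := 1) (by norm_num)
  have h12 := hf1.uncurry_pd2 (m := 1) (by norm_num)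
  have h21 := hf2.uncurry_pd1 (m := 1) (by norm_num)
  have h22 := hf2.uncurry_pd2 (m := 1) (by norm_num)
  have h111 := h11.uncurry_pd1 (m := 0) (by norm_num)
  have h221 := h22.uncurry_pd1 (m := 0) (by norm_num)
  have cont : ∀ {g : ℝ → ℝ → ℝ}, Continuous (Function.uncurry g) →
      Continuous fun q : ℝ × ℝ × ℝ => g q.2.2 (z2 q.1) := fun hg =>
    hg.comp (continuous_snd.snd.prodMk (hz2.continuous.comp continuous_fst))
  have contz : ∀ {g : ℝ → ℝ → ℝ}, Continuous (Function.uncurry g) →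
      Continuous fun t => g (z1 t) (z2 t) := fun hg =>
    hg.comp (hz1.continuous.prodMk hz2.continuous)
  have c1 := cont hf1.continuous
  have c2 := cont hf2.continuous
  have c11 := cont h11.continuous
  have c21 := cont h21.continuous
  have c22 := cont h22.continuous
  have c111 := cont h111.continuous
  have c221 := cont h221.continuous
  have cz11 := contz h11.continuous
  have cz12 := contz h12.continuous
  have cz1 : Continuous (deriv z1) := hz1.continuous_deriv (by norm_num)
  have cz2 : Continuous (deriv z2) := hz2.continuous_deriv (by norm_num)
  have hdz1 : ContDiff ℝ 1 (deriv z1) := hz1.deriv'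
  have czz1 : Continuous (deriv (deriv z1)) := hdz1.continuous_deriv le_rfl
  have key := euler_lagrange_of_minimizer (T := T) (z := z1)
    (L := fun t v x => OM2 f1 f2 ε1 ε2 v (deriv z2 t) x (z2 t))
    (Lv := fun t v x => 2 / ε1 ^ 2 * (v - f1 x (z2 t)))
    (Lx := fun t v x => -(2 / ε1 ^ 2 * (v - f1 x (z2 t)) * pd1 f1 x (z2 t))
      - 2 / ε2 ^ 2 * (deriv z2 t - f2 x (z2 t)) * pd1 f2 x (z2 t)
      + pd1 (pd1 f1) x (z2 t) + pd1 (pd2 f2) x (z2 t))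
    (p' := fun t => 2 / ε1 ^ 2 * (deriv (deriv z1) t
      - (pd1 f1 (z1 t) (z2 t) * deriv z1 t + pd2 f1 (z1 t) (z2 t) * deriv z2 t)))
    hT.le hz1 (by unfold OM2; fun_prop) (by fun_prop) (by fun_prop) ?_ ?_ (by fun_prop) hmin
  · intro t ht
    have h := key t ht
    field_simp at h ⊢
    linear_combination h
  · intro t v x v' x' s hv hx
    have hy := hasDerivAt_const s (z2 t)
    have hsum := ((((hv.sub (hasDerivAt_comp_pd hf1' hx hy)).div_const ε1).pow 2).add
      ((((hasDerivAt_const s (deriv z2 t)).sub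
        (hasDerivAt_comp_pd hf2' hx hy)).div_const ε2).pow 2)).add
      (hasDerivAt_comp_pd h11 hx hy) |>.add (hasDerivAt_comp_pd h22 hx hy)
    refine HasDerivAt.congr_deriv (f := fun s => OM2 f1 f2 ε1 ε2 (v s) (deriv z2 t) (x s) (z2 t))
      hsum ?_
    simp only [Pi.sub_apply, Nat.add_one_sub_one, pow_one, Nat.cast_ofNat]
    field_simp
    ring
  · intro t
    exact ((hdz1.differentiable one_ne_zero t).hasDerivAt.sub (hasDerivAt_comp_pd hf1'
      (hz1.differentiable two_ne_zero t).hasDerivAt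
      (hz2.differentiable two_ne_zero t).hasDerivAt)).const_mul _

lemma OM2action_swap (f1 f2 : ℝ → ℝ → ℝ) (ε1 ε2 T : ℝ) (w1 w2 : ℝ → ℝ) :
    OM2action (fun a b => f2 b a) (fun a b => f1 b a) ε2 ε1 T w2 w1
      = OM2action f1 f2 ε1 ε2 T w1 w2 := by
  unfold OM2action
  congr 1
  ext t
  simp only [OM2, pd1, pd2]
  ring

/-- If a twice continuously differentiable path `z = (z₁, z₂)` with fixed endpoints `a₀`, `b`
minimizes the two-dimensional Onsager–Machlup action over all twice continuously differentiable
paths with the same endpoints, then `z` satisfies the corresponding Euler–Lagrange second-order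
ODE system on `(0, T)`. -/
theorem most_probable_path_two_dim_satisfies_euler_lagrange
    (f1 f2 : ℝ → ℝ → ℝ) (ε1 ε2 T : ℝ) (a0 b : ℝ × ℝ) (z1 z2 : ℝ → ℝ)
    (hf1 : ContDiff ℝ 2 (Function.uncurry f1)) (hf2 : ContDiff ℝ 2 (Function.uncurry f2))
    (hε1 : 0 < ε1) (hε2 : 0 < ε2) (hT : 0 < T)
    (hz1 : ContDiff ℝ 2 z1) (hz2 : ContDiff ℝ 2 z2)
    (hz0 : (z1 0, z2 0) = a0) (hzT : (z1 T, z2 T) = b)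
    (hmin : ∀ w1 w2 : ℝ → ℝ, ContDiff ℝ 2 w1 → ContDiff ℝ 2 w2 →
      (w1 0, w2 0) = a0 → (w1 T, w2 T) = b →
      OM2action f1 f2 ε1 ε2 T z1 z2 ≤ OM2action f1 f2 ε1 ε2 T w1 w2) :
    ∀ t ∈ Set.Ioo (0 : ℝ) T,
      (deriv (deriv z1) t
        = f1 (z1 t) (z2 t) * pd1 f1 (z1 t) (z2 t)
          + (ε1 ^ 2 / ε2 ^ 2) * f2 (z1 t) (z2 t) * pd1 f2 (z1 t) (z2 t)
          + (ε1 ^ 2 / 2) * (pd1 (pd1 f1) (z1 t) (z2 t) + pd1 (pd2 f2) (z1 t) (z2 t))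
          + deriv z2 t *
              (pd2 f1 (z1 t) (z2 t) - (ε1 ^ 2 / ε2 ^ 2) * pd1 f2 (z1 t) (z2 t))) ∧
      (deriv (deriv z2) t
        = f2 (z1 t) (z2 t) * pd2 f2 (z1 t) (z2 t)
          + (ε2 ^ 2 / ε1 ^ 2) * f1 (z1 t) (z2 t) * pd2 f1 (z1 t) (z2 t)
          + (ε2 ^ 2 / 2) * (pd2 (pd2 f2) (z1 t) (z2 t) + pd1 (pd2 f1) (z1 t) (z2 t))
          + deriv z1 t *
              (pd1 f2 (z1 t) (z2 t) - (ε2 ^ 2 / ε1 ^ 2) * pd2 f1 (z1 t) (z2 t))) := by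
  intro t ht
  have hsw : ContDiff ℝ 2 (Prod.swap : ℝ × ℝ → ℝ × ℝ) := contDiff_snd.prodMk contDiff_fst
  refine ⟨OM2action_euler_lagrange_fst hf1 hf2 hε1 hε2 hT hz1 hz2 (fun w hw h0 h1 =>
    hmin w z2 hw hz2 (by rw [h0, hz0]) (by rw [h1, hzT])) t ht, ?_⟩
  rw [pd1_pd2_comm hf1]
  refine OM2action_euler_lagrange_fst (f1 := fun a b => f2 b a) (f2 := fun a b => f1 b a)
    (hf2.comp hsw) (hf1.comp hsw) hε2 hε1 hT hz2 hz1 (fun w hw h0 h1 => ?_) t ht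
  rw [OM2action_swap f1 f2, OM2action_swap f1 f2]
  exact hmin z1 w hz1 hw (by rw [h0, hz0]) (by rw [h1, hzT])
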